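/- Every positive-definite even unimodular quadratic form over ℤ has rank divisible by 8. -/

import Mathlib

open Complex Filter Topology in
/-- A Gaussian sum with bounded coefficients tends to its central term as the width shrinks. -/
theorem tendsto_tsum_mul_exp_neg_mul_sq (c : ℤ → ℂ) (hc : ∀ n, ‖c n‖ ≤ 1) :
    Tendsto (fun t : ℝ ↦ ∑' n : ℤ, c n * cexp (-Real.pi * t * n ^ 2)) atTop (𝓝 (c 0)) := by
  have hnorm (t : ℝ) (n : ℤ) : ‖cexp (-Real.pi * t * n ^ 2)‖ = Real.exp (-Real.pi * t * n ^ 2) := by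
    rw [norm_exp]
    congr 1
    have : (-Real.pi * t * n ^ 2 : ℂ) = ((-Real.pi * t * n ^ 2 : ℝ) : ℂ) := by push_cast; rfl
    rw [this, ofReal_re]
  have hsum : Summable fun n : ℤ ↦ Real.exp (-Real.pi * 1 * n ^ 2) := by
    have h := ((summable_jacobiTheta₂_term_iff 0 I).2 (by simp)).norm
    refine h.congr fun n ↦ ?_
    rw [norm_jacobiTheta₂_term]
    simp
  have hlim : (∑' n : ℤ, if n = 0 then c 0 else 0) = c 0 := tsum_ite_eq 0 fun _ ↦ c 0
  rw [← hlim]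
  refine tendsto_tsum_of_dominated_convergence hsum (fun n ↦ ?_) ?_
  · split_ifs with h
    · subst h; simp
    · rw [tendsto_zero_iff_norm_tendsto_zero]
      have h0 : 0 < Real.pi * (n : ℝ) ^ 2 := by positivity
      have h1 : Tendsto (fun t : ℝ ↦ Real.exp (-Real.pi * t * n ^ 2)) atTop (𝓝 0) := by
        refine Real.tendsto_exp_atBot.comp ?_
        have := tendsto_id.const_mul_atTop_of_neg (neg_lt_zero.2 h0)
        refine this.congr fun t ↦ ?_
        simp only [id]; ring
      have h2 := h1.const_mul ‖c n‖
      rw [mul_zero] at h2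
      refine h2.congr fun t ↦ ?_
      rw [norm_mul, hnorm]
  · filter_upwards [eventually_ge_atTop 1] with t ht n
    rw [norm_mul, hnorm]
    refine (mul_le_of_le_one_left (Real.exp_pos _).le (hc n)).trans (Real.exp_le_exp.2 ?_)
    have : 0 ≤ Real.pi * (n : ℝ) ^ 2 := by positivity
    nlinarith

open Complex Filter Topology in
/-- The quadratic Gauss sum to an even modulus, including its sign. -/
theorem sum_exp_pi_mul_sq_div (N : ℕ) [NeZero N] (hN : Even N) :
    ∑ r : Fin N, cexp (Real.pi * I * (r : ℕ) ^ 2 / N) =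
      (Real.sqrt N : ℂ) * cexp (Real.pi / 4 * I) := by
  have hN0 : (0 : ℝ) < N := by exact_mod_cast Nat.pos_of_neZero N
  have hNC : (N : ℂ) ≠ 0 := by exact_mod_cast hN0.ne'
  have hper (k : ℤ) : cexp (Real.pi * I * N * k) = 1 := by
    obtain ⟨m, hm⟩ := hN
    rw [Complex.exp_eq_one_iff]
    refine ⟨m * k, ?_⟩
    rw [hm]; push_cast; ring
  -- the theta series near the cusp, expanded over residue classes
  have key (t : ℝ) (ht : 0 < t) :
      ∑ r : Fin N, cexp (Real.pi * I * (r : ℕ) ^ 2 / N) *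
        (∑' n : ℤ, cexp (-2 * Real.pi * I * (r : ℕ) * n / N) * cexp (-Real.pi * t * n ^ 2)) =
      1 / (1 / (N ^ 2 * t) - I / N : ℂ) ^ (1 / 2 : ℂ) * (1 + I / (N * t) : ℂ) ^ (1 / 2 : ℂ) *
        ∑' n : ℤ, cexp (-Real.pi * I * n ^ 2 / N) * cexp (-Real.pi * t * n ^ 2) := by
    have htC : (t : ℂ) ≠ 0 := by exact_mod_cast ht.ne'
    set a : ℂ := 1 / (N ^ 2 * t) - I / N with ha
    set c : ℂ := t + I / N with hc
    have hare : a.re = 1 / (N ^ 2 * t) := by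
      have : a = ((1 / (N ^ 2 * t) : ℝ) : ℂ) - ((1 / N : ℝ) : ℂ) * I := by
        rw [ha]; push_cast; ring
      rw [this, sub_re, ofReal_re, re_ofReal_mul, I_re, mul_zero, sub_zero]
    have hcre : c.re = t := by
      have : c = (t : ℂ) + ((1 / N : ℝ) : ℂ) * I := by rw [hc]; push_cast; ring
      rw [this]; simp
    have ha0 : 0 < a.re := by rw [hare]; positivity
    have hc0 : 0 < c.re := by rw [hcre]; exact ht
    have hane : a ≠ 0 := fun h ↦ by simp [h] at ha0
    have hcne : c ≠ 0 := fun h ↦ by simp [h] at hc0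
    have hac : 1 / a = 1 / c + I * N := by
      have e : 1 + I * N * c = I * N * t := by
        rw [hc]; field_simp; linear_combination I_sq
      have e' : a * (I * N * t) = c := by
        rw [ha, hc]; field_simp; linear_combination (-N * t : ℂ) * I_sq
      rw [div_add' _ _ _ hcne, e, div_eq_div_iff hane hcne, ← e']
      ring
    have h1 := Complex.tsum_exp_neg_mul_int_sq ha0
    have h2 := Complex.tsum_exp_neg_mul_int_sq hc0
    have h3 : ∀ n : ℤ, cexp (-Real.pi / a * n ^ 2) = cexp (-Real.pi / c * n ^ 2) := fun n ↦ by
      have : (-Real.pi / a * n ^ 2 : ℂ) =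
          -Real.pi / c * n ^ 2 + Real.pi * I * N * ((-n ^ 2 : ℤ) : ℂ) := by
        rw [div_eq_mul_one_div, hac]; push_cast; ring
      rw [this, Complex.exp_add, hper, mul_one]
    have h4 : (t : ℂ) ^ (1 / 2 : ℂ) ≠ 0 := by simp [cpow_eq_zero_iff, htC]
    have h5 : c ^ (1 / 2 : ℂ) = (t : ℂ) ^ (1 / 2 : ℂ) * (1 + I / (N * t) : ℂ) ^ (1 / 2 : ℂ) := by
      have e : c = t * (1 + I / (N * t)) := by rw [hc]; field_simp
      have hne : (1 + I / (N * t) : ℂ) ≠ 0 := right_ne_zero_of_mul (e ▸ hcne)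
      rw [cpow_def_of_ne_zero hcne, cpow_def_of_ne_zero htC, cpow_def_of_ne_zero hne,
        ← Complex.exp_add, e, Complex.log_ofReal_mul ht hne, ofReal_log ht.le]
      congr 1; ring
    have h6 : c ^ (1 / 2 : ℂ) ≠ 0 := by simp [cpow_eq_zero_iff, hcne]
    have hsum : Summable fun n : ℤ ↦ cexp (-Real.pi * a * n ^ 2) := by
      have := (summable_jacobiTheta₂_term_iff 0 (I * a)).2 (by simpa using ha0)
      refine this.congr fun n ↦ ?_
      rw [jacobiTheta₂_term]
      congr 1
      linear_combination (Real.pi * a * n ^ 2 : ℂ) * I_sq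
    have h7 : ∑' n : ℤ, cexp (-Real.pi * a * n ^ 2) = ∑ r : Fin N,
        cexp (Real.pi * I * (r : ℕ) ^ 2 / N) * ((t : ℂ) ^ (1 / 2 : ℂ) *
        ∑' n : ℤ, cexp (-2 * Real.pi * I * (r : ℕ) * n / N) * cexp (-Real.pi * t * n ^ 2)) := by
      rw [← (Int.divModEquiv N).symm.tsum_eq]
      have hs := (Int.divModEquiv N).symm.summable_iff.2 hsum
      rw [← (Equiv.prodComm _ _).tsum_eq]
      have hs' := (Equiv.prodComm (Fin N) ℤ).summable_iff.2 hs
      refine (Summable.tsum_prod hs').trans ?_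
      rw [tsum_fintype]
      refine Finset.sum_congr rfl fun r _ ↦ ?_
      have hq := Complex.tsum_exp_neg_quadratic (a := t) (by simpa using ht) (-I * (r : ℕ) / N)
      have hq' : ∑' n : ℤ, cexp (-2 * Real.pi * I * (r : ℕ) * n / N) *
          cexp (-Real.pi * t * n ^ 2) = 1 / (t : ℂ) ^ (1 / 2 : ℂ) *
          ∑' n : ℤ, cexp (-Real.pi / t * (n + I * (-I * (r : ℕ) / N)) ^ 2) := by
        rw [← hq]
        refine tsum_congr fun n ↦ ?_
        rw [← Complex.exp_add]; congr 1; ring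
      rw [hq', ← mul_assoc (_ ^ _), mul_one_div_cancel h4, one_mul, ← tsum_mul_left]
      refine tsum_congr fun k ↦ ?_
      simp only [Function.comp, Equiv.prodComm_apply, Prod.swap_prod_mk, Int.divModEquiv_symm_apply]
      rw [← Complex.exp_add]
      have : (-Real.pi * a * ((k * N + (r : ℕ) : ℤ) : ℂ) ^ 2 : ℂ) =
          (Real.pi * I * (r : ℕ) ^ 2 / N + -Real.pi / t * (k + I * (-I * (r : ℕ) / N)) ^ 2) +
            Real.pi * I * N * ((k ^ 2 : ℤ) : ℂ) + 2 * Real.pi * I * ((k * (r : ℕ) : ℤ) : ℂ) := by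
        have hI : I * (-I * (r : ℕ) / N) = (r : ℕ) / N := by
          linear_combination (-((r : ℕ) : ℂ) / N) * I_sq
        rw [hI, ha]
        push_cast
        field_simp
        ring
      rw [this, Complex.exp_add, Complex.exp_add, hper, mul_one,
        show (2 * Real.pi * I * ((k * (r : ℕ) : ℤ) : ℂ)) = ((k * (r : ℕ) : ℤ) : ℂ) * (2 * Real.pi * I)
          by ring, Complex.exp_int_mul_two_pi_mul_I, mul_one]
    have h8 : ∑' n : ℤ, cexp (-Real.pi * I * n ^ 2 / N) * cexp (-Real.pi * t * n ^ 2) =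
        ∑' n : ℤ, cexp (-Real.pi * c * n ^ 2) := by
      refine tsum_congr fun n ↦ ?_
      rw [← Complex.exp_add, hc]; congr 1; ring
    have h9 : (t : ℂ) ^ (1 / 2 : ℂ) * ∑ r : Fin N, cexp (Real.pi * I * (r : ℕ) ^ 2 / N) *
        (∑' n : ℤ, cexp (-2 * Real.pi * I * (r : ℕ) * n / N) * cexp (-Real.pi * t * n ^ 2)) =
        ∑' n : ℤ, cexp (-Real.pi * a * n ^ 2) := by
      rw [h7, Finset.mul_sum]
      exact Finset.sum_congr rfl fun r _ ↦ by ring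
    apply mul_left_cancel₀ h4
    rw [h9, h1, tsum_congr h3, h8, h2]
    rw [h5] at h6 ⊢
    linear_combination (-(1 / a ^ (1 / 2 : ℂ)) * ∑' n : ℤ, cexp (-Real.pi / c * n ^ 2)) *
      mul_one_div_cancel h6
  have hphase (x : ℝ) : ‖cexp (x * I)‖ ≤ 1 := (norm_exp_ofReal_mul_I x).le
  have hL : Tendsto (fun t : ℝ ↦ ∑ r : Fin N, cexp (Real.pi * I * (r : ℕ) ^ 2 / N) *
        (∑' n : ℤ, cexp (-2 * Real.pi * I * (r : ℕ) * n / N) * cexp (-Real.pi * t * n ^ 2)))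
      atTop (𝓝 (∑ r : Fin N, cexp (Real.pi * I * (r : ℕ) ^ 2 / N))) := by
    refine tendsto_finsetSum _ fun r _ ↦ ?_
    have := tendsto_tsum_mul_exp_neg_mul_sq
      (fun n : ℤ ↦ cexp (-2 * Real.pi * I * (r : ℕ) * n / N)) fun n ↦ by
        convert hphase (-2 * Real.pi * (r : ℕ) * n / N) using 3
        push_cast; ring
    simpa using this.const_mul (cexp (Real.pi * I * (r : ℕ) ^ 2 / N))
  have hinv : Tendsto (fun t : ℝ ↦ (1 / t : ℂ)) atTop (𝓝 0) := by
    have := (continuous_ofReal.tendsto 0).comp (tendsto_inv_atTop_zero (𝕜 := ℝ))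
    refine (this.congr fun t ↦ ?_)
    simp
  have hR : Tendsto (fun t : ℝ ↦
      1 / (1 / (N ^ 2 * t) - I / N : ℂ) ^ (1 / 2 : ℂ) * (1 + I / (N * t) : ℂ) ^ (1 / 2 : ℂ) *
        ∑' n : ℤ, cexp (-Real.pi * I * n ^ 2 / N) * cexp (-Real.pi * t * n ^ 2)) atTop
      (𝓝 (1 / (-I / N) ^ (1 / 2 : ℂ) * 1 * 1)) := by
    have hslit : -I / N ∈ slitPlane := by
      refine Or.inr ?_
      rw [show (-I / N : ℂ) = ((-1 / N : ℝ) : ℂ) * I by push_cast; ring, im_ofReal_mul, I_im]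
      simpa using hN0.ne'
    have hne : (-I / N : ℂ) ^ (1 / 2 : ℂ) ≠ 0 := by simp [cpow_eq_zero_iff, hNC]
    refine (Tendsto.mul ?_ ?_).mul ?_
    · refine Tendsto.div tendsto_const_nhds ?_ hne
      refine (continuousAt_cpow_const hslit).tendsto.comp ?_
      have := (hinv.const_mul (1 / N ^ 2 : ℂ)).sub_const (I / N)
      rw [mul_zero, zero_sub, ← neg_div] at this
      refine this.congr fun t ↦ ?_
      ring
    · have := (hinv.const_mul (I / N : ℂ)).const_add 1
      rw [mul_zero, add_zero] at this
      have h1 := (continuousAt_cpow_const (b := (1 / 2 : ℂ)) one_mem_slitPlane).tendsto.comp this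
      rw [one_cpow] at h1
      refine h1.congr fun t ↦ ?_
      simp only [Function.comp]
      congr 1
      ring
    · have := tendsto_tsum_mul_exp_neg_mul_sq
        (fun n : ℤ ↦ cexp (-Real.pi * I * n ^ 2 / N)) fun n ↦ by
          convert hphase (-Real.pi * n ^ 2 / N) using 3
          push_cast; ring
      simpa using this
  have heq := tendsto_nhds_unique (hL.congr' ((eventually_gt_atTop 0).mono key)) hR
  rw [heq, mul_one, mul_one, one_div, ← cpow_neg]
  have hne : (-I / N : ℂ) ≠ 0 := div_ne_zero (neg_ne_zero.2 I_ne_zero) hNC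
  have hlog : log (-I / N) = -Real.log N + -(Real.pi / 2) * I := by
    have : (-I / N : ℂ) = ((N⁻¹ : ℝ) : ℂ) * -I := by push_cast; ring
    rw [this, log_ofReal_mul (by positivity) (neg_ne_zero.2 I_ne_zero), log_neg_I, Real.log_inv]
    push_cast; ring
  rw [cpow_def_of_ne_zero hne, hlog, Real.sqrt_eq_rpow, Real.rpow_def_of_pos hN0, ofReal_exp,
    ← Complex.exp_add]
  congr 1
  push_cast; ring

/-- A quadratic character sum over a finite group is the order of any self-orthogonal subgroup on
which the quadratic character is trivial. -/
theorem sum_quadratic_eq_card {G : Type*} [AddCommGroup G] [Fintype G] (f : G → ℂ)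
    (β : G → AddChar G ℂ) (hf : ∀ y h, f (y + h) = f y * f h * β y h) (H : AddSubgroup G)
    (hH : ∀ h ∈ H, f h = 1) (hperp : ∀ y, (∀ h ∈ H, β y h = 1) → y ∈ H) :
    ∑ y, f y = Nat.card H := by
  classical
  have hβ (y : G) : ∑ h : H, β y h = if y ∈ H then (Nat.card H : ℂ) else 0 := by
    have := AddChar.sum_eq_ite ((β y).compAddMonoidHom H.subtype)
    simp only [AddChar.compAddMonoidHom_apply, AddSubgroup.subtype_apply] at this
    rw [this, Nat.card_eq_fintype_card]
    refine if_congr ⟨fun h ↦ hperp y fun x hx ↦ ?_, fun hy ↦ ?_⟩ rfl rfl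
    · simpa using DFunLike.congr_fun h (⟨x, hx⟩ : H)
    · ext x
      have := hf y x
      rw [hH _ (H.add_mem hy x.2), hH _ hy, hH _ x.2] at this
      simpa using this.symm
  have hcard : (Nat.card H : ℂ) ≠ 0 := by exact_mod_cast Nat.card_pos.ne'
  apply mul_left_cancel₀ hcard
  calc (Nat.card H : ℂ) * ∑ y, f y = ∑ h : H, ∑ y, f (y + h) := by
        have hshift (h : H) : ∑ y, f (y + h) = ∑ y, f y :=
          Fintype.sum_equiv (Equiv.addRight (h : G)) _ f fun _ ↦ rfl
        simp [hshift, Nat.card_eq_fintype_card]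
    _ = ∑ y, f y * ∑ h : H, β y h := by
        rw [Finset.sum_comm]
        refine Finset.sum_congr rfl fun y _ ↦ ?_
        rw [Finset.mul_sum]
        exact Finset.sum_congr rfl fun h _ ↦ by rw [hf, hH _ h.2, mul_one]
    _ = ∑ y, if y ∈ H then (Nat.card H : ℂ) else 0 := by
        refine Finset.sum_congr rfl fun y _ ↦ ?_
        rw [hβ]
        split_ifs with h
        · rw [hH _ h, one_mul]
        · rw [mul_zero]
    _ = Nat.card H * Nat.card H := by
        rw [← Finset.sum_filter, Finset.sum_const, nsmul_eq_mul, ← Fintype.card_subtype]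
        congr 2
        rw [Nat.card_eq_fintype_card]

/-- An integral symmetric matrix is diagonalized by an integral matrix of nonzero determinant. -/
theorem exists_transpose_mul_mul_eq_diagonal {n : ℕ} (A : Matrix (Fin n) (Fin n) ℤ)
    (hA : A.IsSymm) :
    ∃ (P : Matrix (Fin n) (Fin n) ℤ) (d : Fin n → ℤ),
      P.det ≠ 0 ∧ P.transpose * A * P = Matrix.diagonal d := by
  set Aq : Matrix (Fin n) (Fin n) ℚ := A.map (Int.castRingHom ℚ) with hAq
  have hAqs : Aq.IsSymm := hA.map _
  have hB : LinearMap.IsSymm (Matrix.toBilin' Aq) := by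
    refine ⟨fun x y ↦ ?_⟩
    simp only [Matrix.toBilin'_apply', RingHom.id_apply]
    rw [Matrix.dotProduct_mulVec, ← Matrix.mulVec_transpose, hAqs.eq, dotProduct_comm]
  obtain ⟨v₀, hv₀⟩ := LinearMap.BilinForm.exists_orthogonal_basis hB
  set e : Fin (Module.finrank ℚ (Fin n → ℚ)) ≃ Fin n := finCongr (by simp)
  set v := v₀.reindex e with hv
  have hort : ∀ i j, i ≠ j → v i ⬝ᵥ Aq.mulVec (v j) = 0 := fun i j hij ↦ by
    have := hv₀ (e.symm.injective.ne hij)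
    simpa [hv, Function.onFun, Matrix.toBilin'_apply'] using this
  set M := (Pi.basisFun ℚ (Fin n)).toMatrix v with hM
  have hMdet : M.det ≠ 0 := by
    have := (Pi.basisFun ℚ (Fin n)).invertibleToMatrix v
    exact (Matrix.isUnit_det_of_invertible M).ne_zero
  have hMij (i j) : M i j = v j i := by simp [hM, Module.Basis.toMatrix_apply]
  obtain ⟨b, hb⟩ := IsLocalization.exist_integer_multiples_of_finite (nonZeroDivisors ℤ)
    (fun ij : Fin n × Fin n ↦ M ij.1 ij.2)
  choose p hp using hb
  let P : Matrix (Fin n) (Fin n) ℤ := Matrix.of fun i j ↦ p (i, j)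
  have hPM : P.map (Int.castRingHom ℚ) = ((b : ℤ) : ℚ) • M := by
    ext i j
    simpa [P, Submonoid.smul_def] using hp (i, j)
  have hb0 : ((b : ℤ) : ℚ) ≠ 0 := by exact_mod_cast nonZeroDivisors.ne_zero b.2
  refine ⟨P, fun i ↦ (P.transpose * A * P) i i, fun h ↦ ?_, ?_⟩
  · have h1 : (P.map (Int.castRingHom ℚ)).det = 0 := by
      rw [← RingHom.mapMatrix_apply, ← RingHom.map_det, h, map_zero]
    rw [hPM, Matrix.det_smul] at h1
    exact mul_ne_zero (pow_ne_zero _ hb0) hMdet h1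
  · ext i j
    by_cases hij : i = j
    · subst hij; simp
    · rw [Matrix.diagonal_apply_ne _ hij]
      have h1 : (P.transpose * A * P).map (Int.castRingHom ℚ) =
          ((b : ℤ) : ℚ) • ((b : ℤ) : ℚ) • (M.transpose * Aq * M) := by
        rw [Matrix.map_mul, Matrix.map_mul, Matrix.transpose_map, hPM, ← hAq,
          Matrix.transpose_smul, Matrix.smul_mul, Matrix.mul_smul, Matrix.smul_mul]
      have h2 : (M.transpose * Aq * M) i j = 0 := by
        rw [← hort i j hij, Matrix.mul_assoc, Matrix.mul_apply]
        simp [dotProduct, hMij, Matrix.mulVec, Matrix.mul_apply]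
      have h3 := congrFun (congrFun h1 i) j
      rw [Matrix.smul_apply, Matrix.smul_apply, h2, smul_zero, smul_zero, Matrix.map_apply] at h3
      simpa using h3

/-- A symmetric integral matrix with even diagonal represents only even integers. -/
theorem even_dotProduct_mulVec {ι : Type*} [Fintype ι] [DecidableEq ι]
    (A : Matrix ι ι ℤ) (hA : A.IsSymm) (heven : ∀ i, Even (A i i)) (v : ι → ℤ) :
    Even (v ⬝ᵥ A.mulVec v) := by
  rw [← ZMod.intCast_eq_zero_iff_even]
  have h : ((v ⬝ᵥ A.mulVec v : ℤ) : ZMod 2) =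
      ∑ x : ι × ι, (v x.1 : ZMod 2) * (A x.1 x.2 * v x.2) := by
    rw [Fintype.sum_prod_type]
    simp [dotProduct, Matrix.mulVec, Finset.mul_sum]
  rw [h]
  refine Finset.sum_involution (fun x _ ↦ x.swap) (fun x _ ↦ ?_) (fun x _ hx hsw ↦ hx ?_)
    (fun _ _ ↦ Finset.mem_univ _) fun x _ ↦ Prod.swap_swap x
  · rw [Prod.fst_swap, Prod.snd_swap, hA.apply]
    have : (2 : ZMod 2) = 0 := rfl
    linear_combination ((v x.1 : ZMod 2) * (A x.2 x.1 * v x.2)) * this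
  · have h1 : x.2 = x.1 := congrArg Prod.fst hsw
    have h2 : ((A x.1 x.1 : ℤ) : ZMod 2) = 0 := ZMod.intCast_eq_zero_iff_even.2 (heven _)
    rw [h1, h2]; ring

/-- The quadratic character of `ZMod N`, for even `N`. -/
noncomputable def zmodQuadratic (N : ℕ) (x : ZMod N) : ℂ :=
  Complex.exp (Real.pi * Complex.I * (x.val : ℂ) ^ 2 / N)

theorem zmodQuadratic_intCast {N : ℕ} [NeZero N] (hN : Even N) (z : ℤ) :
    zmodQuadratic N z = Complex.exp (Real.pi * Complex.I * z ^ 2 / N) := by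
  have hNC : (N : ℂ) ≠ 0 := by exact_mod_cast NeZero.ne N
  obtain ⟨m, hm⟩ := hN
  have hval : ((z : ZMod N).val : ℤ) = z % N := ZMod.val_intCast z
  have hz : (z : ℂ) = ((z : ZMod N).val : ℂ) + N * ((z / N : ℤ) : ℂ) := by
    have h : z = ((z : ZMod N).val : ℤ) + N * (z / N) := by
      rw [hval]; exact (Int.emod_add_mul_ediv z N).symm
    exact_mod_cast congrArg (Int.cast : ℤ → ℂ) h
  rw [zmodQuadratic, Complex.exp_eq_exp_iff_exists_int]
  refine ⟨-((z : ZMod N).val * (z / N) + m * (z / N) ^ 2), ?_⟩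
  have hm' : (N : ℂ) = m + m := by exact_mod_cast hm
  generalize (z : ZMod N).val = r at *
  rw [hz]
  push_cast
  field_simp
  rw [hm']
  ring

theorem zmodQuadratic_add {N : ℕ} [NeZero N] (hN : Even N) (x y : ZMod N) :
    zmodQuadratic N (x + y) =
      zmodQuadratic N x * zmodQuadratic N y * ZMod.stdAddChar (x * y) := by
  obtain ⟨a, rfl⟩ := ZMod.intCast_surjective x
  obtain ⟨b, rfl⟩ := ZMod.intCast_surjective y
  rw [← Int.cast_add, ← Int.cast_mul, zmodQuadratic_intCast hN, zmodQuadratic_intCast hN,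
    zmodQuadratic_intCast hN, ZMod.stdAddChar_coe, ← Complex.exp_add, ← Complex.exp_add]
  congr 1
  push_cast
  ring

theorem sum_zmodQuadratic {N : ℕ} [NeZero N] (hN : Even N) :
    ∑ x, zmodQuadratic N x = (Real.sqrt N : ℂ) * Complex.exp (Real.pi / 4 * Complex.I) := by
  rw [← sum_exp_pi_mul_sq_div N hN]
  obtain _ | k := N
  · exact absurd rfl (NeZero.ne 0)
  · rfl
theorem norm_exp_pi_div_four : ‖Complex.exp (Real.pi / 4 * Complex.I)‖ = 1 := by
  have := Complex.norm_exp_ofReal_mul_I (Real.pi / 4)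
  push_cast at this
  exact this

open Matrix in
/-- The product of the Gauss sums of a diagonal sublattice of an even unimodular lattice is a
positive integer. -/
theorem exists_prod_sum_zmodQuadratic_eq {n : ℕ} (A P : Matrix (Fin n) (Fin n) ℤ)
    (hsymm : A.IsSymm) (heven : ∀ i, Even (A i i)) (hunimod : IsUnit A.det) (hP : P.det ≠ 0)
    (N : Fin n → ℕ) [∀ i, NeZero (N i)] (hN : ∀ i, Even (N i))
    (hd : Pᵀ * A * P = diagonal fun i ↦ (N i : ℤ)) :
    ∃ k : ℕ, 0 < k ∧ ∏ i, ∑ x, zmodQuadratic (N i) x = k := by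
  classical
  have hNC (i) : (N i : ℂ) ≠ 0 := by exact_mod_cast NeZero.ne (N i)
  have hAA : A * A⁻¹ = 1 := mul_nonsing_inv A hunimod
  let c := Int.castRingHom ℂ
  have hdC : (P.map c)ᵀ * A.map c * P.map c = diagonal fun i ↦ (N i : ℂ) := by
    rw [← transpose_map, ← Matrix.map_mul, ← Matrix.map_mul, hd, diagonal_map (map_zero c)]
    simp [c]
  have hPC : IsUnit (P.map c).det := by
    rw [← RingHom.mapMatrix_apply, ← RingHom.map_det]
    simpa [c] using hP
  -- the inverse Gram matrix in terms of the diagonal form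
  have hinv : P.map c * diagonal (fun i ↦ (N i : ℂ)⁻¹) * (P.map c)ᵀ = A⁻¹.map c := by
    have h1 : P.map c * diagonal (fun i ↦ (N i : ℂ)⁻¹) * (P.map c)ᵀ * A.map c = 1 := by
      have h2 : P.map c * diagonal (fun i ↦ (N i : ℂ)⁻¹) * (P.map c)ᵀ * A.map c * P.map c =
          1 * P.map c := by
        rw [Matrix.mul_assoc, Matrix.mul_assoc, ← Matrix.mul_assoc (P.map c)ᵀ, hdC,
          Matrix.mul_assoc, diagonal_mul_diagonal]
        simp [hNC]
      have h3 := congrArg (· * (P.map c)⁻¹) h2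
      simpa only [mul_nonsing_inv_cancel_right _ _ hPC] using h3
    have h4 : A.map c * A⁻¹.map c = 1 := by
      rw [← Matrix.map_mul, hAA, Matrix.map_one c (map_zero c) (map_one c)]
    calc _ = P.map c * diagonal (fun i ↦ (N i : ℂ)⁻¹) * (P.map c)ᵀ * (A.map c * A⁻¹.map c) := by
          rw [h4, Matrix.mul_one]
      _ = A⁻¹.map c := by rw [← Matrix.mul_assoc, h1, Matrix.one_mul]
  have hcast (M : Matrix (Fin n) (Fin n) ℤ) (w : Fin n → ℤ) (i) :
      (((M *ᵥ w) i : ℤ) : ℂ) = (M.map c *ᵥ fun j ↦ (w j : ℂ)) i := by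
    simp [mulVec, dotProduct, c]
  have hpair (w w' : Fin n → ℤ) :
      ∑ i, (((Pᵀ *ᵥ w) i : ℤ) : ℂ) * ((Pᵀ *ᵥ w') i : ℤ) / N i = (w ⬝ᵥ A⁻¹ *ᵥ w' : ℤ) := by
    have h1 : ((w ⬝ᵥ A⁻¹ *ᵥ w' : ℤ) : ℂ) =
        (fun j ↦ (w j : ℂ)) ⬝ᵥ A⁻¹.map c *ᵥ fun j ↦ (w' j : ℂ) := by
      simp [mulVec, dotProduct, c]
    rw [h1, ← hinv, ← mulVec_mulVec, ← mulVec_mulVec, dotProduct_mulVec, ← mulVec_transpose]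
    refine Finset.sum_congr rfl fun i _ ↦ ?_
    rw [hcast, hcast, transpose_map, mulVec_diagonal]
    ring
  let f : (∀ i, ZMod (N i)) → ℂ := fun y ↦ ∏ i, zmodQuadratic (N i) (y i)
  let β : (∀ i, ZMod (N i)) → AddChar (∀ i, ZMod (N i)) ℂ := fun y ↦
    { toFun := fun h ↦ ∏ i, ZMod.stdAddChar (y i * h i)
      map_zero_eq_one' := by simp
      map_add_eq_mul' := fun a b ↦ by
        simp [mul_add, AddChar.map_add_eq_mul, Finset.prod_mul_distrib] }
  have hf_apply (y) : f y = ∏ i, zmodQuadratic (N i) (y i) := rfl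
  have hβ_apply (y h) : β y h = ∏ i, ZMod.stdAddChar (y i * h i) := rfl
  let φ : (Fin n → ℤ) →+ (∀ i, ZMod (N i)) :=
    { toFun := fun w i ↦ ((Pᵀ *ᵥ w) i : ℤ)
      map_zero' := by ext; simp
      map_add' := fun a b ↦ by ext; simp [mulVec_add] }
  have hβ (z : Fin n → ℤ) (w : Fin n → ℤ) : β (fun i ↦ (z i : ZMod (N i))) (φ w) =
      Complex.exp (2 * Real.pi * Complex.I * ∑ i, (z i : ℂ) * ((Pᵀ *ᵥ w) i : ℤ) / N i) := by
    change ∏ i, ZMod.stdAddChar ((z i : ZMod (N i)) * (((Pᵀ *ᵥ w) i : ℤ) : ZMod (N i))) = _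
    rw [Finset.mul_sum, Complex.exp_sum]
    refine Finset.prod_congr rfl fun i _ ↦ ?_
    rw [← Int.cast_mul, ZMod.stdAddChar_coe]
    congr 1
    push_cast
    ring
  refine ⟨Nat.card φ.range, Nat.card_pos, ?_⟩
  rw [Finset.prod_univ_sum, Fintype.piFinset_univ]
  refine sum_quadratic_eq_card f β (fun y h ↦ ?_) φ.range ?_ fun y hy ↦ ?_
  · rw [hf_apply, hf_apply, hf_apply, hβ_apply, ← Finset.prod_mul_distrib,
      ← Finset.prod_mul_distrib]
    exact Finset.prod_congr rfl fun i _ ↦ zmodQuadratic_add (hN i) _ _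
  · rintro _ ⟨w, rfl⟩
    change ∏ i, zmodQuadratic (N i) ((Pᵀ *ᵥ w) i : ℤ) = 1
    simp_rw [zmodQuadratic_intCast (hN _), ← Complex.exp_sum]
    have h1 : ∑ i, Real.pi * Complex.I * (((Pᵀ *ᵥ w) i : ℤ) : ℂ) ^ 2 / N i =
        Real.pi * Complex.I * (w ⬝ᵥ A⁻¹ *ᵥ w : ℤ) := by
      rw [← hpair, Finset.mul_sum]
      exact Finset.sum_congr rfl fun i _ ↦ by ring
    have h2 : w ⬝ᵥ A⁻¹ *ᵥ w = (A⁻¹ *ᵥ w) ⬝ᵥ A *ᵥ (A⁻¹ *ᵥ w) := by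
      rw [mulVec_mulVec, hAA, one_mulVec, dotProduct_comm]
    obtain ⟨m, hm⟩ := even_dotProduct_mulVec A hsymm heven (A⁻¹ *ᵥ w)
    rw [h1, h2, hm, Complex.exp_eq_one_iff]
    exact ⟨m, by push_cast; ring⟩
  · choose z hz using fun i ↦ ZMod.intCast_surjective (y i)
    obtain rfl : (fun i ↦ (z i : ZMod (N i))) = y := funext hz
    have h1 (w : Fin n → ℤ) : ∃ k : ℤ, ∑ i, (z i : ℂ) * ((Pᵀ *ᵥ w) i : ℤ) / N i = k := by
      have := hy (φ w) ⟨w, rfl⟩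
      rw [hβ, Complex.exp_eq_one_iff] at this
      obtain ⟨k, hk⟩ := this
      refine ⟨k, mul_left_cancel₀ Complex.two_pi_I_ne_zero ?_⟩
      rw [hk, mul_comm]
    choose u hu using fun j ↦ h1 (Pi.single j 1)
    have h2 : P.map c *ᵥ (diagonal (fun i ↦ (N i : ℂ)⁻¹) *ᵥ fun i ↦ (z i : ℂ)) =
        fun j ↦ (u j : ℂ) := by
      ext j
      rw [← hu, mulVec, dotProduct]
      refine Finset.sum_congr rfl fun i _ ↦ ?_
      rw [mulVec_single_one, mulVec_diagonal]
      simp [c]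
      ring
    refine ⟨A *ᵥ u, ?_⟩
    funext i
    change (((Pᵀ *ᵥ (A *ᵥ u)) i : ℤ) : ZMod (N i)) = z i
    congr 1
    apply Int.cast_injective (α := ℂ)
    rw [mulVec_mulVec, hcast, Matrix.map_mul, transpose_map, ← h2, mulVec_mulVec, hdC,
      mulVec_mulVec, diagonal_mul_diagonal]
    simp [hNC]

/-- Every positive-definite even unimodular quadratic form over ℤ has rank
divisible by 8. -/
theorem stmt_3 (n : ℕ) (A : Matrix (Fin n) (Fin n) ℤ) (hsymm : A.IsSymm)
    (heven : ∀ i, Even (A i i)) (hunimod : A.det = 1 ∨ A.det = -1)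
    (hpos : (A.map ((↑) : ℤ → ℝ)).PosDef) : 8 ∣ n := by
  obtain ⟨P, d, hP, hd⟩ := exists_transpose_mul_mul_eq_diagonal A hsymm
  have hdi (i) : d i = P.col i ⬝ᵥ A.mulVec (P.col i) := by
    have := congrFun (congrFun hd i) i
    rw [Matrix.diagonal_apply_eq, Matrix.mul_assoc, Matrix.mul_apply] at this
    rw [← this]
    rfl
  have hdpos (i) : 0 < d i := by
    have hcol : (fun j ↦ (P.col i j : ℝ)) ≠ 0 := fun h ↦ hP <|
      Matrix.det_eq_zero_of_column_eq_zero i fun j ↦ by simpa using congrFun h j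
    have := hpos.dotProduct_mulVec_pos hcol
    have h2 : (0 : ℝ) < (d i : ℝ) := by
      rw [hdi]
      refine this.trans_eq ?_
      simp [Matrix.mulVec, dotProduct]
    exact_mod_cast h2
  have hdeven (i) : Even (d i) := hdi i ▸ even_dotProduct_mulVec A hsymm heven _
  lift d to Fin n → ℕ using fun i ↦ (hdpos i).le
  have hne (i) : NeZero (d i) := ⟨by have := hdpos i; simp at this; omega⟩
  have hdeven' (i) : Even (d i) := by simpa using hdeven i
  obtain ⟨k, hk, hprod⟩ := exists_prod_sum_zmodQuadratic_eq A P hsymm heven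
    (Int.isUnit_iff.2 hunimod) hP d hdeven' hd
  simp_rw [fun i ↦ sum_zmodQuadratic (hdeven' i)] at hprod
  rw [Finset.prod_mul_distrib, Finset.prod_const, Finset.card_univ, Fintype.card_fin,
    ← Complex.ofReal_prod] at hprod
  have hnorm := congrArg norm hprod
  rw [norm_mul, norm_pow, norm_exp_pi_div_four, one_pow, mul_one, Complex.norm_real,
    Complex.norm_natCast, Real.norm_of_nonneg (Finset.prod_nonneg fun _ _ ↦ Real.sqrt_nonneg _)]
    at hnorm
  rw [hnorm, Complex.ofReal_natCast] at hprod
  have hone := mul_left_cancel₀ (by exact_mod_cast hk.ne') (hprod.trans (mul_one _).symm)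
  rw [← Complex.exp_nat_mul, Complex.exp_eq_one_iff] at hone
  obtain ⟨m, hm⟩ := hone
  have hn : (n : ℂ) = 8 * m := by
    apply mul_right_cancel₀ Complex.two_pi_I_ne_zero
    linear_combination 8 * hm
  have hn' : (n : ℤ) = 8 * m := by exact_mod_cast hn
  exact Int.natCast_dvd_natCast.1 ⟨m, hn'⟩
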